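/- Let c_{a,b}^r = C(2r,2a+2) − (1 − 1/2^{2r})·C(2r,2b+1), let Ĥ(a,b) = 2∑_{r=1}^{a+b+1} (-1)^r c_{a,b}^r ζ(2r+1) ζ(2,…,2) (with a+b+1−r twos), and let F̂(x,y) = ∑_{a,b≥0} (-1)^{a+b+1} Ĥ(a,b) x^{2a+2} y^{2b+1}. Then for all real x, y with |x| and |y| sufficiently small and y ≠ 0, one has (π/sin(πy))·F̂(x,y) = ψ(1+y) + ψ(1−y) − (1/2)[ψ(1+x+y) + ψ(1−x−y) + ψ(1+x−y) + ψ(1−x+y)] − (sin(πx)/(2 sin(πy)))·[ψ(1+(x+y)/2) + ψ(1−(x+y)/2) − ψ(1+(x−y)/2) − ψ(1−(x−y)/2) − ψ(1+x+y) − ψ(1−x−y) + ψ(1+x−y) + ψ(1−x+y)]. -/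

import Mathlib

open scoped BigOperators

/-- The multiple zeta value `ζ(k 0, …, k (n-1))`. -/
noncomputable def mzv {n : ℕ} (k : Fin n → ℕ) : ℝ :=
  ∑' m : Fin n → ℕ+, if StrictMono m then ∏ i, (1 : ℝ) / ((m i : ℕ) : ℝ) ^ (k i) else 0

/-- The Riemann zeta value `ζ(k)` as a real series. -/
noncomputable def riemannZetaReal (k : ℕ) : ℝ := ∑' n : ℕ+, (1 : ℝ) / ((n : ℕ) : ℝ) ^ k

/-- The coefficient `c_{a,b}^r = C(2r,2a+2) − (1 − 1/2^{2r}) C(2r,2b+1)`. -/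
noncomputable def cCoeff (a b r : ℕ) : ℝ :=
  (Nat.choose (2 * r) (2 * a + 2) : ℝ) -
    (1 - 1 / 2 ^ (2 * r)) * (Nat.choose (2 * r) (2 * b + 1) : ℝ)

/-- `Ĥ(a,b) = 2 ∑_{r=1}^{a+b+1} (-1)^r c_{a,b}^r ζ(2r+1) ζ(2,…,2)` with `a+b+1−r` twos. -/
noncomputable def Hhat (a b : ℕ) : ℝ :=
  2 * ∑ r ∈ Finset.Icc 1 (a + b + 1),
    (-1 : ℝ) ^ r * cCoeff a b r * riemannZetaReal (2 * r + 1) *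
      mzv (fun _ : Fin (a + b + 1 - r) => 2)

/-- The generating function `F̂(x,y) = ∑_{a,b≥0} (-1)^{a+b+1} Ĥ(a,b) x^{2a+2} y^{2b+1}`. -/
noncomputable def FhatGen (x y : ℝ) : ℝ :=
  ∑' a : ℕ, ∑' b : ℕ, (-1 : ℝ) ^ (a + b + 1) * Hhat a b * x ^ (2 * a + 2) * y ^ (2 * b + 1)

/-- The digamma function `ψ(x) = Γ'(x)/Γ(x)`. -/
noncomputable def digamma (x : ℝ) : ℝ := deriv Real.Gamma x / Real.Gamma x

open Filter Topology
open Finset.HasAntidiagonal (antidiagonal mem_antidiagonal)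

theorem hasDerivAt_log_comp_Gamma {z : ℝ} (hz : 0 < z) :
    HasDerivAt (Real.log ∘ Real.Gamma) (digamma z) z := by
  have hd : DifferentiableAt ℝ Real.Gamma z :=
    Real.differentiableAt_Gamma fun m h => by
      have : (0 : ℝ) ≤ m := m.cast_nonneg
      linarith
  exact hd.hasDerivAt.log (Real.Gamma_pos_of_pos hz).ne'

theorem log_Gamma_add_one {z : ℝ} (hz : 0 < z) :
    Real.log (Real.Gamma (z + 1)) = Real.log z + Real.log (Real.Gamma z) := by
  rw [Real.Gamma_add_one hz.ne', Real.log_mul hz.ne' (Real.Gamma_pos_of_pos hz).ne']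

theorem digamma_add_one {z : ℝ} (hz : 0 < z) : digamma (z + 1) = digamma z + 1 / z := by
  have h₁ : HasDerivAt (fun s => (Real.log ∘ Real.Gamma) (s + 1)) (digamma (z + 1)) z :=
    (hasDerivAt_log_comp_Gamma (by linarith : 0 < z + 1)).comp_add_const z 1
  have h₂ : HasDerivAt (fun s => Real.log s + (Real.log ∘ Real.Gamma) s)
      (z⁻¹ + digamma z) z :=
    (Real.hasDerivAt_log hz.ne').add (hasDerivAt_log_comp_Gamma hz)
  have h₃ : (fun s => (Real.log ∘ Real.Gamma) (s + 1)) =ᶠ[𝓝 z]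
      fun s => Real.log s + (Real.log ∘ Real.Gamma) s := by
    filter_upwards [lt_mem_nhds hz] with s hs using log_Gamma_add_one hs
  rw [h₁.unique (h₂.congr_of_eventuallyEq h₃), one_div, add_comm]

theorem digamma_le_log {z : ℝ} (hz : 0 < z) : digamma z ≤ Real.log z := by
  have h := Real.convexOn_log_Gamma.le_slope_of_hasDerivAt (Set.mem_Ioi.2 hz)
    (Set.mem_Ioi.2 (by linarith : 0 < z + 1)) (by linarith) (hasDerivAt_log_comp_Gamma hz)
  simpa [slope_def_field, log_Gamma_add_one hz] using h

theorem log_sub_one_le_digamma {z : ℝ} (hz : 1 < z) : Real.log (z - 1) ≤ digamma z := by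
  have hz' : 0 < z - 1 := by linarith
  have h := Real.convexOn_log_Gamma.slope_le_of_hasDerivAt (Set.mem_Ioi.2 hz')
    (Set.mem_Ioi.2 (by linarith : 0 < z)) (by linarith)
    (hasDerivAt_log_comp_Gamma (by linarith : 0 < z))
  have e := log_Gamma_add_one hz'
  rw [sub_add_cancel] at e
  simpa [slope_def_field, e] using h

theorem tendsto_digamma_sub_log : Tendsto (fun z => digamma z - Real.log z) atTop (𝓝 0) := by
  refine tendsto_of_tendsto_of_tendsto_of_le_of_le'
    (Real.tendsto_log_comp_add_sub_log (-1)) tendsto_const_nhds ?_ ?_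
  · filter_upwards [eventually_gt_atTop 1] with z hz
    simpa [sub_eq_add_neg] using log_sub_one_le_digamma hz
  · filter_upwards [eventually_gt_atTop 0] with z hz
    simpa using digamma_le_log hz

theorem tendsto_digamma_add_sub_digamma (t : ℝ) :
    Tendsto (fun z => digamma (z + t) - digamma z) atTop (𝓝 0) := by
  have h := ((tendsto_digamma_sub_log.comp (tendsto_atTop_add_const_right atTop t tendsto_id)).add
    (Real.tendsto_log_comp_add_sub_log t)).sub tendsto_digamma_sub_log
  simp only [add_zero, sub_zero] at h
  refine h.congr fun z => ?_
  simp only [Function.comp_apply, id]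
  ring

/-- The even part of the digamma function about `1`, as a series of partial fractions. -/
theorem hasSum_digamma_even_part {t : ℝ} (ht : |t| < 1) :
    HasSum (fun k : ℕ => t ^ 2 / ((k + 1) * ((k + 1) ^ 2 - t ^ 2)))
      (digamma 1 - (digamma (1 + t) + digamma (1 - t)) / 2) := by
  obtain ⟨ht₁, ht₂⟩ := abs_lt.1 ht
  have hsq : t ^ 2 < 1 := by nlinarith
  have hden (k : ℕ) : 0 < ((k : ℝ) + 1) ^ 2 - t ^ 2 := by
    have : (0 : ℝ) ≤ k := k.cast_nonneg
    nlinarith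
  rw [hasSum_iff_tendsto_nat_of_nonneg fun k => by have := hden k; positivity]
  have hpartial (n : ℕ) : ∑ k ∈ Finset.range n, t ^ 2 / (((k : ℝ) + 1) * ((k + 1) ^ 2 - t ^ 2)) =
      digamma 1 - (digamma (1 + t) + digamma (1 - t)) / 2 +
        ((digamma ((n : ℝ) + 1 + t) - digamma (n + 1)) +
          (digamma ((n : ℝ) + 1 + -t) - digamma (n + 1))) / 2 := by
    induction n with
    | zero => simp [sub_eq_add_neg]; ring
    | succ n ih =>
      have hn : (0 : ℝ) ≤ n := n.cast_nonneg
      have h₀ : 0 < (n : ℝ) + 1 := by linarith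
      have h₁ : 0 < (n : ℝ) + 1 + t := by linarith
      have h₂ : 0 < (n : ℝ) + 1 + -t := by linarith
      have h₃ := hden n
      rw [Finset.sum_range_succ, ih]
      push_cast
      rw [add_right_comm ((n : ℝ) + 1) 1 t, add_right_comm ((n : ℝ) + 1) 1 (-t),
        digamma_add_one h₀, digamma_add_one h₁, digamma_add_one h₂]
      have : t ^ 2 / (((n : ℝ) + 1) * ((n + 1) ^ 2 - t ^ 2)) =
          (1 / ((n : ℝ) + 1 + t) + 1 / ((n : ℝ) + 1 + -t)) / 2 - 1 / ((n : ℝ) + 1) := by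
        have e : ((n : ℝ) + 1) ^ 2 - t ^ 2 = ((n : ℝ) + 1 + t) * ((n : ℝ) + 1 + -t) := by ring
        rw [e]
        field_simp
        ring
      rw [this]
      ring
  simp_rw [hpartial]
  have hlim : Tendsto (fun n : ℕ => (n : ℝ) + 1) atTop atTop :=
    tendsto_atTop_add_const_right _ _ tendsto_natCast_atTop_atTop
  have h := ((((tendsto_digamma_add_sub_digamma t).comp hlim).add
    ((tendsto_digamma_add_sub_digamma (-t)).comp hlim)).div_const 2).const_add
      (digamma 1 - (digamma (1 + t) + digamma (1 - t)) / 2)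
  simpa using h

theorem riemannZetaReal_eq_tsum_nat (k : ℕ) :
    riemannZetaReal k = ∑' n : ℕ, (1 : ℝ) / ((n : ℝ) + 1) ^ k := by
  rw [riemannZetaReal, ← Equiv.pnatEquivNat.symm.tsum_eq]
  simp [Nat.succPNat]

theorem hasSum_zeta_odd {t : ℝ} (ht : |t| < 1) :
    HasSum (fun m : ℕ => riemannZetaReal (2 * m + 3) * t ^ (2 * m + 2))
      (digamma 1 - (digamma (1 + t) + digamma (1 - t)) / 2) := by
  let F : ℕ × ℕ → ℝ := fun p => t ^ (2 * p.2 + 2) / ((p.1 : ℝ) + 1) ^ (2 * p.2 + 3)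
  have hF : 0 ≤ F := fun p => by
    have : 0 ≤ t ^ (2 * p.2 + 2) := Even.pow_nonneg ⟨p.2 + 1, by ring⟩ t
    simp only [F, Pi.zero_apply]
    positivity
  have hsq : t ^ 2 < 1 := by rw [← sq_abs]; nlinarith [abs_nonneg t]
  have hrow (k : ℕ) : HasSum (fun m => F (k, m)) (t ^ 2 / ((k + 1) * ((k + 1) ^ 2 - t ^ 2))) := by
    have hk : (0 : ℝ) ≤ k := k.cast_nonneg
    have hk' : (0 : ℝ) < (k + 1) ^ 2 - t ^ 2 := by nlinarith
    have hr : t ^ 2 / ((k : ℝ) + 1) ^ 2 < 1 := by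
      rw [div_lt_one (by positivity)]
      linarith
    convert! (hasSum_geometric_of_lt_one (by positivity) hr).mul_left
      (t ^ 2 / ((k : ℝ) + 1) ^ 3) using 1
    · ext m
      simp only [F]
      rw [div_pow, ← pow_mul, ← pow_mul, div_mul_div_comm, ← pow_add, ← pow_add]
      ring_nf
    · have : 1 - t ^ 2 / ((k : ℝ) + 1) ^ 2 = ((k + 1) ^ 2 - t ^ 2) / (k + 1) ^ 2 := by
        field_simp
      rw [this]
      field_simp
  have hS : Summable F := (summable_prod_of_nonneg hF).2
    ⟨fun k => (hrow k).summable, by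
      simpa only [(hrow _).tsum_eq] using (hasSum_digamma_even_part ht).summable⟩
  have hval : HasSum F (digamma 1 - (digamma (1 + t) + digamma (1 - t)) / 2) := by
    have h := hS.hasSum.prod_fiberwise hrow
    rw [← h.unique (hasSum_digamma_even_part ht)]
    exact hS.hasSum
  have hswap := (Equiv.prodComm ℕ ℕ).hasSum_iff.2 hval
  convert! hswap.prod_fiberwise fun m => (hswap.summable.prod_factor m).hasSum using 1
  ext m
  simp only [F, Function.comp_apply, Equiv.prodComm_apply, Prod.swap_prod_mk]
  rw [riemannZetaReal_eq_tsum_nat, ← tsum_mul_right]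
  exact tsum_congr fun k => by rw [one_div_mul_eq_div]

theorem mzv_two_eq_tsum_finset (n : ℕ) :
    mzv (fun _ : Fin n => 2) =
      ∑' s : {s : Finset ℕ+ // s.card = n}, ∏ i ∈ s.1, (1 : ℝ) / ((i : ℕ) : ℝ) ^ 2 := by
  let e : {m : Fin n → ℕ+ // StrictMono m} ≃ {s : Finset ℕ+ // s.card = n} :=
    { toFun := fun m => ⟨Finset.univ.map ⟨m.1, m.2.injective⟩, by simp⟩
      invFun := fun s => ⟨s.1.orderEmbOfFin s.2, (s.1.orderEmbOfFin s.2).strictMono⟩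
      left_inv := fun m => Subtype.ext
        (Finset.orderEmbOfFin_unique _ (fun i => by simp) m.2).symm
      right_inv := fun s => Subtype.ext (by
        ext i
        have := Set.ext_iff.1 (Finset.range_orderEmbOfFin s.1 s.2) i
        rw [Set.mem_range, Finset.mem_coe] at this
        simpa using! this) }
  rw [← e.tsum_eq, mzv]
  have h := tsum_subtype {m : Fin n → ℕ+ | StrictMono m}
    (fun m => ∏ i, (1 : ℝ) / ((m i : ℕ) : ℝ) ^ 2)
  simp only [Set.indicator_apply, Set.mem_ofPred_eq] at h
  rw [← h]
  refine tsum_congr fun m => ?_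
  simp [e]

theorem hasSum_mzv_two_sin (y : ℝ) :
    HasSum (fun n : ℕ => (-1) ^ n * mzv (fun _ : Fin n => 2) * y ^ (2 * n + 1))
      (Real.sin (Real.pi * y) / Real.pi) := by
  let f : ℕ+ → ℝ := fun i => -y ^ 2 * (1 / ((i : ℕ) : ℝ) ^ 2)
  have hf : Summable fun i => ‖f i‖ := by
    refine Summable.norm (Summable.mul_left _ ?_)
    exact (Real.summable_one_div_nat_pow.2 one_lt_two).comp_injective PNat.coe_injective
  have hS := summable_finsetProd_of_summable_norm hf
  have hprod := hasProd_one_add_of_hasSum_prod hS.hasSum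
  have hnat := (Equiv.pnatEquivNat.symm.hasProd_iff.2 hprod).tendsto_prod_nat.const_mul
    (Real.pi * y)
  have hval : Real.pi * y * ∑' s : Finset ℕ+, ∏ i ∈ s, f i = Real.sin (Real.pi * y) := by
    refine tendsto_nhds_unique hnat ((Real.tendsto_euler_sin_prod y).congr fun n => ?_)
    congr 1
    refine Finset.prod_congr rfl fun j _ => ?_
    simp [f, Nat.succPNat, sub_eq_add_neg, div_eq_mul_inv]
  have hsigma := (Equiv.sigmaFiberEquiv (Finset.card (α := ℕ+))).hasSum_iff.2 hS.hasSum
  have hfib := (hsigma.sigma fun n => (hsigma.summable.sigma_factor n).hasSum).mul_left y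
  convert! hfib using 1
  · ext n
    have (s : {s : Finset ℕ+ // s.card = n}) : ∏ i ∈ s.1, f i =
        (-y ^ 2) ^ n * ∏ i ∈ s.1, (1 : ℝ) / ((i : ℕ) : ℝ) ^ 2 := by
      simp only [f, Finset.prod_mul_distrib, Finset.prod_const, s.2]
    simp only [Function.comp_apply, Equiv.sigmaFiberEquiv_apply, this]
    rw [tsum_mul_left, ← mzv_two_eq_tsum_finset, neg_pow (y ^ 2)]
    ring
  · rw [← hval]
    field_simp

theorem hasSum_prod_sum_antidiagonal {f : ℕ × ℕ → ℝ} {g : ℕ → ℝ} {A B : ℝ}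
    (hf : HasSum f A) (hg : HasSum g B) :
    HasSum (fun p : ℕ × ℕ => ∑ q ∈ antidiagonal p.2, f (p.1, q.1) * g q.2) (A * B) := by
  let e : (Σ p : ℕ × ℕ, antidiagonal p.2) ≃ (ℕ × ℕ) × ℕ :=
    { toFun := fun s => ((s.1.1, s.2.1.1), s.2.1.2)
      invFun := fun s => ⟨(s.1.1, s.1.2 + s.2), ⟨(s.1.2, s.2), by simp⟩⟩
      left_inv := by
        rintro ⟨⟨a, b⟩, ⟨⟨j, n⟩, h⟩⟩
        obtain rfl := mem_antidiagonal.1 h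
        rfl
      right_inv := fun _ => rfl }
  have h := e.hasSum_iff.2
    (hf.mul hg (summable_mul_of_summable_norm hf.summable.norm hg.summable.norm))
  convert! h.sigma fun p => hasSum_fintype _ using 1
  ext p
  exact (Finset.sum_coe_sort (antidiagonal p.2)
    fun q => f (p.1, q.1) * g q.2).symm

theorem hasSum_of_hasSum_sum_antidiagonal {f : ℕ × ℕ → ℝ} {A : ℝ}
    (habs : Summable fun m => ∑ q ∈ antidiagonal m, |f q|)
    (h : HasSum (fun m => ∑ q ∈ antidiagonal m, f q) A) : HasSum f A := by
  let e : (Σ m : ℕ, antidiagonal m) ≃ ℕ × ℕ :=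
    Finset.HasAntidiagonal.sigmaAntidiagonalEquivProd
  have hS : Summable f := by
    rw [← summable_abs_iff, ← e.summable_iff]
    refine (summable_sigma_of_nonneg fun _ => abs_nonneg _).2
      ⟨fun m => (hasSum_fintype _).summable, ?_⟩
    convert! habs using 2 with m
    rw [tsum_fintype]
    exact Finset.sum_coe_sort (antidiagonal m) fun q => |f q|
  have hs := (e.hasSum_iff.2 hS.hasSum).sigma fun m => hasSum_fintype _
  have : A = ∑' q, f q := by
    refine h.unique ?_
    convert! hs using 1
    ext m
    exact (Finset.sum_coe_sort (antidiagonal m) fun q => f q).symm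
  rw [this]
  exact hS.hasSum

theorem sum_range_two_mul_add_one (g : ℕ → ℝ) (n : ℕ) :
    ∑ i ∈ Finset.range (2 * n + 1), g i =
      g 0 + ∑ k ∈ Finset.range n, g (2 * k + 1) + ∑ k ∈ Finset.range n, g (2 * k + 2) := by
  induction n with
  | zero => simp
  | succ n ih =>
    rw [show 2 * (n + 1) + 1 = 2 * n + 1 + 1 + 1 by ring, Finset.sum_range_succ,
      Finset.sum_range_succ, ih, Finset.sum_range_succ, Finset.sum_range_succ]
    ring

theorem add_pow_two_mul_add_two (x y : ℝ) (m : ℕ) :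
    (x + y) ^ (2 * m + 2) = y ^ (2 * m + 2) +
      ∑ q ∈ antidiagonal m,
        ((2 * m + 2).choose (2 * q.1 + 1) : ℝ) * x ^ (2 * q.1 + 1) * y ^ (2 * q.2 + 1) +
      ∑ q ∈ antidiagonal m,
        ((2 * m + 2).choose (2 * q.1 + 2) : ℝ) * x ^ (2 * q.1 + 2) * y ^ (2 * q.2) := by
  rw [add_pow, show 2 * m + 2 + 1 = 2 * (m + 1) + 1 by ring, sum_range_two_mul_add_one,
    Finset.Nat.sum_antidiagonal_eq_sum_range_succ_mk,
    Finset.Nat.sum_antidiagonal_eq_sum_range_succ_mk]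
  congr 1
  · congr 1
    · simp
    · refine Finset.sum_congr rfl fun k hk => ?_
      have hk := Finset.mem_range.1 hk
      rw [show 2 * m + 2 - (2 * k + 1) = 2 * (m - k) + 1 by omega]
      ring
  · refine Finset.sum_congr rfl fun k hk => ?_
    have hk := Finset.mem_range.1 hk
    rw [show 2 * m + 2 - (2 * k + 2) = 2 * (m - k) by omega]
    ring

theorem neg_add_pow_two_mul_add_two (x y : ℝ) (m : ℕ) :
    (-x + y) ^ (2 * m + 2) = y ^ (2 * m + 2) -
      ∑ q ∈ antidiagonal m,
        ((2 * m + 2).choose (2 * q.1 + 1) : ℝ) * x ^ (2 * q.1 + 1) * y ^ (2 * q.2 + 1) +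
      ∑ q ∈ antidiagonal m,
        ((2 * m + 2).choose (2 * q.1 + 2) : ℝ) * x ^ (2 * q.1 + 2) * y ^ (2 * q.2) := by
  have hodd (k : ℕ) : (-x) ^ (2 * k + 1) = -x ^ (2 * k + 1) := Odd.neg_pow ⟨k, rfl⟩ x
  have heven (k : ℕ) : (-x) ^ (2 * k + 2) = x ^ (2 * k + 2) := Even.neg_pow ⟨k + 1, by ring⟩ x
  rw [add_pow_two_mul_add_two, sub_eq_add_neg, ← Finset.sum_neg_distrib]
  simp_rw [hodd, heven, mul_neg, neg_mul]

theorem sum_antidiagonal_choose_even (x y : ℝ) (m : ℕ) :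
    ∑ q ∈ antidiagonal m,
        ((2 * m + 2).choose (2 * q.1 + 2) : ℝ) * x ^ (2 * q.1 + 2) * y ^ (2 * q.2) =
      ((x + y) ^ (2 * m + 2) + (-x + y) ^ (2 * m + 2)) / 2 - y ^ (2 * m + 2) := by
  rw [neg_add_pow_two_mul_add_two, add_pow_two_mul_add_two]
  ring

theorem sum_antidiagonal_choose_odd (x y : ℝ) (m : ℕ) :
    ∑ q ∈ antidiagonal m,
        ((2 * m + 2).choose (2 * q.1 + 1) : ℝ) * x ^ (2 * q.1 + 1) * y ^ (2 * q.2 + 1) =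
      ((x + y) ^ (2 * m + 2) - (-x + y) ^ (2 * m + 2)) / 2 := by
  rw [neg_add_pow_two_mul_add_two, add_pow_two_mul_add_two]
  ring

section EvenSeries

variable {w : ℕ → ℝ} {W : ℝ → ℝ}

theorem hasSum_choose_even (hw : ∀ m, 0 ≤ w m)
    (hW : ∀ t, |t| < 1 → HasSum (fun m => w m * t ^ (2 * m + 2)) (W t)) {x y : ℝ}
    (hxy : |x| + |y| < 1) :
    HasSum (fun p : ℕ × ℕ => w (p.1 + p.2) *
        (((2 * (p.1 + p.2) + 2).choose (2 * p.1 + 2) : ℝ) * x ^ (2 * p.1 + 2) * y ^ (2 * p.2)))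
      ((W (x + y) + W (-x + y)) / 2 - W y) := by
  have hrow (x y : ℝ) (hxy : |x| + |y| < 1) : HasSum (fun m => ∑ q ∈ antidiagonal m,
      w (q.1 + q.2) * (((2 * (q.1 + q.2) + 2).choose (2 * q.1 + 2) : ℝ) *
        x ^ (2 * q.1 + 2) * y ^ (2 * q.2))) ((W (x + y) + W (-x + y)) / 2 - W y) := by
    have h₁ := hW (x + y) ((abs_add_le x y).trans_lt hxy)
    have h₂ := hW (-x + y) ((abs_add_le (-x) y).trans_lt (by rwa [abs_neg]))
    have h₃ := hW y (by linarith [abs_nonneg x])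
    convert! ((h₁.add h₂).div_const 2).sub h₃ using 1
    ext m
    rw [show (w m * (x + y) ^ (2 * m + 2) + w m * (-x + y) ^ (2 * m + 2)) / 2 -
        w m * y ^ (2 * m + 2) = w m * (((x + y) ^ (2 * m + 2) + (-x + y) ^ (2 * m + 2)) / 2 -
          y ^ (2 * m + 2)) by ring, ← sum_antidiagonal_choose_even, Finset.mul_sum]
    exact Finset.sum_congr rfl fun q hq => by rw [mem_antidiagonal.1 hq]
  refine hasSum_of_hasSum_sum_antidiagonal ?_ (hrow x y hxy)
  refine (hrow |x| |y| (by simpa using hxy)).summable.congr fun m => ?_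
  refine Finset.sum_congr rfl fun q _ => ?_
  simp only [abs_mul, abs_pow, abs_of_nonneg (hw _), Nat.abs_cast]

theorem hasSum_choose_odd (hw : ∀ m, 0 ≤ w m)
    (hW : ∀ t, |t| < 1 → HasSum (fun m => w m * t ^ (2 * m + 2)) (W t)) {x y : ℝ}
    (hxy : |x| + |y| < 1) :
    HasSum (fun p : ℕ × ℕ => w (p.1 + p.2) *
        (((2 * (p.1 + p.2) + 2).choose (2 * p.1 + 1) : ℝ) * x ^ (2 * p.1 + 1) *
          y ^ (2 * p.2 + 1)))
      ((W (x + y) - W (-x + y)) / 2) := by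
  have hrow (x y : ℝ) (hxy : |x| + |y| < 1) : HasSum (fun m => ∑ q ∈ antidiagonal m,
      w (q.1 + q.2) * (((2 * (q.1 + q.2) + 2).choose (2 * q.1 + 1) : ℝ) *
        x ^ (2 * q.1 + 1) * y ^ (2 * q.2 + 1))) ((W (x + y) - W (-x + y)) / 2) := by
    have h₁ := hW (x + y) ((abs_add_le x y).trans_lt hxy)
    have h₂ := hW (-x + y) ((abs_add_le (-x) y).trans_lt (by rwa [abs_neg]))
    convert! (h₁.sub h₂).div_const 2 using 1
    ext m
    rw [show (w m * (x + y) ^ (2 * m + 2) - w m * (-x + y) ^ (2 * m + 2)) / 2 =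
        w m * (((x + y) ^ (2 * m + 2) - (-x + y) ^ (2 * m + 2)) / 2) by ring,
      ← sum_antidiagonal_choose_odd, Finset.mul_sum]
    exact Finset.sum_congr rfl fun q hq => by rw [mem_antidiagonal.1 hq]
  refine hasSum_of_hasSum_sum_antidiagonal ?_ (hrow x y hxy)
  refine (hrow |x| |y| (by simpa using hxy)).summable.congr fun m => ?_
  refine Finset.sum_congr rfl fun q _ => ?_
  simp only [abs_mul, abs_pow, abs_of_nonneg (hw _), Nat.abs_cast]

end EvenSeries

theorem sum_Icc_eq_sum_antidiagonal (a b : ℕ) (F : ℕ → ℝ) (hF : ∀ r ≤ a, F r = 0) :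
    ∑ r ∈ Finset.Icc 1 (a + b + 1), F r = ∑ q ∈ antidiagonal b, F (a + q.1 + 1) := by
  rw [Finset.Nat.sum_antidiagonal_eq_sum_range_succ_mk, ← Finset.Ico_add_one_right_eq_Icc,
    Finset.sum_Ico_eq_sum_range, show a + b + 1 + 1 - 1 = a + (b + 1) by omega,
    Finset.sum_range_add, Finset.sum_eq_zero fun i hi => hF _ (by
      have := Finset.mem_range.1 hi
      omega), zero_add]
  exact Finset.sum_congr rfl fun k _ => by congr 1; ring

theorem Hhat_term_eq (x y : ℝ) (a b : ℕ) :
    (-1 : ℝ) ^ (a + b + 1) * Hhat a b * x ^ (2 * a + 2) * y ^ (2 * b + 1) =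
      2 * (∑ q ∈ antidiagonal b,
        riemannZetaReal (2 * (a + q.1) + 3) *
          (((2 * (a + q.1) + 2).choose (2 * a + 2) : ℝ) * x ^ (2 * a + 2) * y ^ (2 * q.1)) *
          ((-1) ^ q.2 * mzv (fun _ : Fin q.2 => 2) * y ^ (2 * q.2 + 1)) -
      ∑ q ∈ antidiagonal a,
        (1 - 1 / 2 ^ (2 * (b + q.1) + 2)) * riemannZetaReal (2 * (b + q.1) + 3) *
          (((2 * (b + q.1) + 2).choose (2 * b + 1) : ℝ) * y ^ (2 * b + 1) *
            x ^ (2 * q.1 + 1)) *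
          ((-1) ^ q.2 * mzv (fun _ : Fin q.2 => 2) * x ^ (2 * q.2 + 1))) := by
  have hsign (n r : ℕ) (h : r ≤ n) : (-1 : ℝ) ^ n * (-1) ^ r = (-1) ^ (n - r) := by
    obtain ⟨k, rfl⟩ := Nat.exists_eq_add_of_le h
    rw [Nat.add_sub_cancel_left, pow_add, mul_right_comm, ← mul_pow]
    simp
  have hsplit : (-1 : ℝ) ^ (a + b + 1) * Hhat a b * x ^ (2 * a + 2) * y ^ (2 * b + 1) =
      2 * (∑ r ∈ Finset.Icc 1 (a + b + 1), ((2 * r).choose (2 * a + 2) : ℝ) *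
        (riemannZetaReal (2 * r + 1) * ((-1) ^ (a + b + 1 - r) *
          mzv (fun _ : Fin (a + b + 1 - r) => 2)) * x ^ (2 * a + 2) * y ^ (2 * b + 1)) -
      ∑ r ∈ Finset.Icc 1 (b + a + 1), ((2 * r).choose (2 * b + 1) : ℝ) *
        ((1 - 1 / 2 ^ (2 * r)) * riemannZetaReal (2 * r + 1) * ((-1) ^ (a + b + 1 - r) *
          mzv (fun _ : Fin (a + b + 1 - r) => 2)) * x ^ (2 * a + 2) * y ^ (2 * b + 1))) := by
    rw [add_comm b a, ← Finset.sum_sub_distrib, Hhat]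
    simp only [Finset.mul_sum, Finset.sum_mul]
    refine Finset.sum_congr rfl fun r hr => ?_
    rw [← hsign _ _ (Finset.mem_Icc.1 hr).2, cCoeff]
    ring
  rw [hsplit, sum_Icc_eq_sum_antidiagonal a b _ fun r hr => by
      rw [Nat.choose_eq_zero_of_lt (by omega)]; simp,
    sum_Icc_eq_sum_antidiagonal b a _ fun r hr => by
      rw [Nat.choose_eq_zero_of_lt (by omega)]; simp]
  congr 2
  · refine Finset.sum_congr rfl fun q hq => ?_
    have hq := mem_antidiagonal.1 hq
    rw [show a + b + 1 - (a + q.1 + 1) = q.2 by omega, ← hq,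
      show 2 * (a + q.1 + 1) = 2 * (a + q.1) + 2 by ring]
    ring
  · refine Finset.sum_congr rfl fun q hq => ?_
    have hq := mem_antidiagonal.1 hq
    rw [show a + b + 1 - (b + q.1 + 1) = q.2 by omega, ← hq,
      show 2 * (b + q.1 + 1) = 2 * (b + q.1) + 2 by ring]
    ring

theorem riemannZetaReal_nonneg (k : ℕ) : 0 ≤ riemannZetaReal k :=
  tsum_nonneg fun _ => by positivity

theorem hasSum_zeta_odd_sub_half {t : ℝ} (ht : |t| < 1) :
    HasSum (fun m : ℕ => (1 - 1 / 2 ^ (2 * m + 2)) * riemannZetaReal (2 * m + 3) *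
        t ^ (2 * m + 2))
      ((digamma 1 - (digamma (1 + t) + digamma (1 - t)) / 2) -
        (digamma 1 - (digamma (1 + t / 2) + digamma (1 - t / 2)) / 2)) := by
  have ht' : |t / 2| < 1 := by
    rw [abs_div, abs_two]
    linarith [abs_nonneg t]
  convert! (hasSum_zeta_odd ht).sub (hasSum_zeta_odd ht') using 1
  ext m
  rw [div_pow]
  ring

theorem FhatGen_eq_digamma_expression :
    ∃ ε > (0 : ℝ), ∀ x y : ℝ, |x| < ε → |y| < ε → y ≠ 0 →
      Real.pi / Real.sin (Real.pi * y) * FhatGen x y =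
        digamma (1 + y) + digamma (1 - y) -
          (1 / 2) * (digamma (1 + x + y) + digamma (1 - x - y) + digamma (1 + x - y) +
            digamma (1 - x + y)) -
          Real.sin (Real.pi * x) / (2 * Real.sin (Real.pi * y)) *
            (digamma (1 + (x + y) / 2) + digamma (1 - (x + y) / 2) -
              digamma (1 + (x - y) / 2) - digamma (1 - (x - y) / 2) -
              digamma (1 + x + y) - digamma (1 - x - y) +
              digamma (1 + x - y) + digamma (1 - x + y)) := by
  refine ⟨1 / 2, by norm_num, fun x y hx hy hy0 => ?_⟩
  have hxy : |x| + |y| < 1 := by linarith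
  have hyx : |y| + |x| < 1 := by linarith
  have hw (m : ℕ) : 0 ≤ (1 - 1 / 2 ^ (2 * m + 2)) * riemannZetaReal (2 * m + 3) := by
    refine mul_nonneg (sub_nonneg.2 ?_) (riemannZetaReal_nonneg _)
    exact div_le_one_of_le₀ (one_le_pow₀ one_le_two) (by positivity)
  have h₁ := hasSum_prod_sum_antidiagonal
    (hasSum_choose_even (fun m => riemannZetaReal_nonneg (2 * m + 3))
      (fun t ht => hasSum_zeta_odd ht) hxy) (hasSum_mzv_two_sin y)
  have h₂ := (Equiv.prodComm ℕ ℕ).hasSum_iff.2 (hasSum_prod_sum_antidiagonal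
    (hasSum_choose_odd hw (fun t ht => hasSum_zeta_odd_sub_half ht) hyx) (hasSum_mzv_two_sin x))
  have h := (h₁.sub h₂).mul_left 2
  have hF := (tsum_congr fun a => tsum_congr fun b => Hhat_term_eq x y a b).trans
    (h.summable.tsum_prod.symm.trans h.tsum_eq)
  have hsin : Real.sin (Real.pi * y) ≠ 0 := by
    rw [Ne, Real.sin_eq_zero_iff_of_lt_of_lt]
    · exact mul_ne_zero Real.pi_ne_zero hy0
    · nlinarith [Real.pi_pos, (abs_lt.1 hy).1]
    · nlinarith [Real.pi_pos, (abs_lt.1 hy).2]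
  rw [FhatGen, hF, show 1 + (-x + y) = 1 - x + y by ring, show 1 - (-x + y) = 1 + x - y by ring,
    show 1 + (x + y) = 1 + x + y by ring, show 1 - (x + y) = 1 - x - y by ring,
    show 1 + (-y + x) = 1 + x - y by ring, show 1 - (-y + x) = 1 - x + y by ring,
    show 1 + (y + x) = 1 + x + y by ring, show 1 - (y + x) = 1 - x - y by ring,
    show (-y + x) / 2 = (x - y) / 2 by ring, add_comm y x]
  have := Real.pi_ne_zero
  field_simp
  ring
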